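/- Let G be a generalized (m,n)-ladder graph. If for each edge e ∈ [G₁,G₂] at least one of the four sets L↑(e) ∩ R↓(e), L↑(e) ∩ R↑(e), L↓(e) ∩ R↑(e), L↓(e) ∩ R↓(e) is empty, then G is planar. -/

import Mathlib

open SimpleGraph

/-- `G` contains a subdivision of `H`: there is an injection `f` of the vertices of `H`
into the vertices of `G` and, for each edge of `H`, a path in `G` between the images of its
endpoints, such that the paths pass through no branch vertices other than their own endpoints
and paths corresponding to distinct edges are internally disjoint. -/
def ContainsSubdivision {V W : Type*} (G : SimpleGraph V) (H : SimpleGraph W) : Prop :=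
  ∃ f : W → V, Function.Injective f ∧
    ∃ p : ∀ ⦃a b : W⦄, H.Adj a b → G.Walk (f a) (f b),
      (∀ ⦃a b : W⦄ (h : H.Adj a b), (p h).IsPath) ∧
      (∀ ⦃a b : W⦄ (h : H.Adj a b) (w : W), f w ∈ (p h).support → w = a ∨ w = b) ∧
      (∀ ⦃a b a' b' : W⦄ (h : H.Adj a b) (h' : H.Adj a' b'), s(a, b) ≠ s(a', b') →
        ∀ v, v ∈ (p h).support → v ∈ (p h').support →
          (v = f a ∨ v = f b) ∧ (v = f a' ∨ v = f b'))

/-- A graph is planar iff it contains no subdivision of `K₅` or `K₃,₃` (Kuratowski). -/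
def IsPlanar {V : Type*} (G : SimpleGraph V) : Prop :=
  ¬ ContainsSubdivision G (completeGraph (Fin 5)) ∧
  ¬ ContainsSubdivision G (completeBipartiteGraph (Fin 3) (Fin 3))

/-- A graph is outerplanar iff it contains no subdivision of `K₄` or `K₃,₂`
(Chartrand–Harary). -/
def IsOuterplanar {V : Type*} (G : SimpleGraph V) : Prop :=
  ¬ ContainsSubdivision G (completeGraph (Fin 4)) ∧
  ¬ ContainsSubdivision G (completeBipartiteGraph (Fin 3) (Fin 2))

/-- The base relation of a generalized (m,n)-ladder graph: consecutive vertices on each of the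
two paths are adjacent, and `u i` is adjacent to `v j` exactly when `(i, j)` is a cross edge. -/
def ladderRel (m n : ℕ) (cross : Finset (Fin m × Fin n)) :
    Fin m ⊕ Fin n → Fin m ⊕ Fin n → Prop
  | Sum.inl i, Sum.inl j => (i : ℕ) + 1 = (j : ℕ)
  | Sum.inr i, Sum.inr j => (i : ℕ) + 1 = (j : ℕ)
  | Sum.inl i, Sum.inr j => (i, j) ∈ cross
  | Sum.inr _, Sum.inl _ => False

/-- The generalized (m,n)-ladder graph determined by the set `cross` of cross edges
`[G₁, G₂]`.  Vertices `Sum.inl i` are the vertices `u_{i+1}` of the path `G₁` and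
vertices `Sum.inr j` are the vertices `v_{j+1}` of the path `G₂`. -/
def ladderGraph (m n : ℕ) (cross : Finset (Fin m × Fin n)) :
    SimpleGraph (Fin m ⊕ Fin n) :=
  SimpleGraph.fromRel (ladderRel m n cross)

/-- `L↑(e)`: the cross edges `e'` with `l(e) < l(e')`. -/
def Lup {m n : ℕ} (cross : Finset (Fin m × Fin n)) (e : Fin m × Fin n) :
    Finset (Fin m × Fin n) := cross.filter fun e' => e.1 < e'.1

/-- `L↓(e)`: the cross edges `e'` with `l(e') < l(e)`. -/
def Ldown {m n : ℕ} (cross : Finset (Fin m × Fin n)) (e : Fin m × Fin n) :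
    Finset (Fin m × Fin n) := cross.filter fun e' => e'.1 < e.1

/-- `R↑(e)`: the cross edges `e'` with `r(e) < r(e')`. -/
def Rup {m n : ℕ} (cross : Finset (Fin m × Fin n)) (e : Fin m × Fin n) :
    Finset (Fin m × Fin n) := cross.filter fun e' => e.2 < e'.2

/-- `R↓(e)`: the cross edges `e'` with `r(e') < r(e)`. -/
def Rdown {m n : ℕ} (cross : Finset (Fin m × Fin n)) (e : Fin m × Fin n) :
    Finset (Fin m × Fin n) := cross.filter fun e' => e'.2 < e.2

/-- The parity of crossings between the chords `a b` and `c d`, where `s x y` is the bit saying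
whether `x` precedes `y`. -/
def chordCrossing {V : Type*} (s : V → V → ZMod 2) (a b c d : V) : ZMod 2 :=
  s a c + s a d + s b c + s b d

/-- The total weight of the darts of a walk with respect to the vertex `v`. -/
def walkWeight {V : Type*} {G : SimpleGraph V} (w : V → V → V → ZMod 2) (v : V) :
    ∀ {a b : V}, G.Walk a b → ZMod 2
  | _, _, .nil => 0
  | _, _, .cons (u := a) (v := b) _ p => w a b v + walkWeight w v p

/-- A certificate that the crossing parities of independent edges form a coboundary
(vanishing of the mod 2 van Kampen obstruction). -/
def IsCrossingCoboundary {V : Type*} (G : SimpleGraph V) (s : V → V → ZMod 2)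
    (w : V → V → V → ZMod 2) : Prop :=
  ∀ a b c d, G.Adj a b → G.Adj c d → a ≠ c → a ≠ d → b ≠ c → b ≠ d →
    chordCrossing s a b c d = w a b c + w a b d + w c d a + w c d b

lemma IsCrossingCoboundary.edge_walk {V : Type*} {G : SimpleGraph V} {s : V → V → ZMod 2}
    {w : V → V → V → ZMod 2} (hw : IsCrossingCoboundary G s w) {a b : V} (hab : G.Adj a b)
    {c d : V} (q : G.Walk c d) (ha : a ∉ q.support) (hb : b ∉ q.support) :
    chordCrossing s a b c d = w a b c + w a b d + walkWeight w a q + walkWeight w b q := by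
  induction q with
  | nil =>
    simp only [chordCrossing, walkWeight]
    grind
  | @cons c e d hce q ih =>
    simp only [Walk.support_cons, List.mem_cons, not_or] at ha hb
    have h₁ := ih ha.2 hb.2
    have hae : a ≠ e := fun h => ha.2 (h ▸ q.start_mem_support)
    have hbe : b ≠ e := fun h => hb.2 (h ▸ q.start_mem_support)
    have h₂ := hw a b c e hab hce ha.1 hae hb.1 hbe
    simp only [chordCrossing, walkWeight] at *
    grind

lemma IsCrossingCoboundary.walk_walk {V : Type*} {G : SimpleGraph V} {s : V → V → ZMod 2}
    {w : V → V → V → ZMod 2} (hw : IsCrossingCoboundary G s w) {a b c d : V}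
    (p : G.Walk a b) (q : G.Walk c d) (hpq : ∀ v ∈ p.support, v ∉ q.support) :
    chordCrossing s a b c d =
      walkWeight w c p + walkWeight w d p + walkWeight w a q + walkWeight w b q := by
  induction p with
  | nil =>
    simp only [chordCrossing, walkWeight]
    grind
  | @cons a e b hae p ih =>
    simp only [Walk.support_cons, List.mem_cons, forall_eq_or_imp] at hpq
    have h₁ := ih hpq.2
    have h₂ := hw.edge_walk hae q hpq.1 (hpq.2 _ p.start_mem_support)
    simp only [chordCrossing, walkWeight] at *
    grind

lemma IsCrossingCoboundary.of_containsSubdivision {V W : Type*} {G : SimpleGraph V}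
    {H : SimpleGraph W} {s : V → V → ZMod 2} {w : V → V → V → ZMod 2}
    (hw : IsCrossingCoboundary G s w) (hs : ∀ x y, x ≠ y → s x y + s y x = 1)
    (hGH : ContainsSubdivision G H) :
    ∃ s' w', (∀ x y : W, x ≠ y → s' x y + s' y x = 1) ∧ IsCrossingCoboundary H s' w' := by
  classical
  obtain ⟨f, hf, p, -, -, hp⟩ := hGH
  refine ⟨fun x y => s (f x) (f y),
    fun a b v => if h : H.Adj a b then walkWeight w (f v) (p h) else 0,
    fun x y hxy => hs _ _ (hf.ne hxy), ?_⟩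
  intro a b c d hab hcd hac had hbc hbd
  simp only [hab, hcd, dif_pos]
  refine hw.walk_walk (p hab) (p hcd) fun v hv hv' => ?_
  have hne : s(a, b) ≠ s(c, d) := by
    simp [hac, had]
  obtain ⟨h₁ | h₁, h₂ | h₂⟩ := hp hab hcd hne v hv hv'
  · exact hac (hf (h₁.symm.trans h₂))
  · exact had (hf (h₁.symm.trans h₂))
  · exact hbc (hf (h₁.symm.trans h₂))
  · exact hbd (hf (h₁.symm.trans h₂))

lemma not_isCrossingCoboundary_completeGraph {s : Fin 5 → Fin 5 → ZMod 2}
    {w : Fin 5 → Fin 5 → Fin 5 → ZMod 2} (hs : ∀ x y, x ≠ y → s x y + s y x = 1) :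
    ¬ IsCrossingCoboundary (completeGraph (Fin 5)) s w := by
  intro hw
  have h0 := hw 0 1 2 3 (by simp) (by simp) (by simp) (by simp) (by simp) (by simp)
  have h1 := hw 0 1 2 4 (by simp) (by simp) (by simp) (by simp) (by simp) (by simp)
  have h2 := hw 0 1 3 4 (by simp) (by simp) (by simp) (by simp) (by simp) (by simp)
  have h3 := hw 0 2 1 3 (by simp) (by simp) (by simp) (by simp) (by simp) (by simp)
  have h4 := hw 0 2 1 4 (by simp) (by simp) (by simp) (by simp) (by simp) (by simp)
  have h5 := hw 0 2 3 4 (by simp) (by simp) (by simp) (by simp) (by simp) (by simp)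
  have h6 := hw 0 3 1 2 (by simp) (by simp) (by simp) (by simp) (by simp) (by simp)
  have h7 := hw 0 3 1 4 (by simp) (by simp) (by simp) (by simp) (by simp) (by simp)
  have h8 := hw 0 3 2 4 (by simp) (by simp) (by simp) (by simp) (by simp) (by simp)
  have h9 := hw 0 4 1 2 (by simp) (by simp) (by simp) (by simp) (by simp) (by simp)
  have h10 := hw 0 4 1 3 (by simp) (by simp) (by simp) (by simp) (by simp) (by simp)
  have h11 := hw 0 4 2 3 (by simp) (by simp) (by simp) (by simp) (by simp) (by simp)
  have h12 := hw 1 2 3 4 (by simp) (by simp) (by simp) (by simp) (by simp) (by simp)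
  have h13 := hw 1 3 2 4 (by simp) (by simp) (by simp) (by simp) (by simp) (by simp)
  have h14 := hw 1 4 2 3 (by simp) (by simp) (by simp) (by simp) (by simp) (by simp)
  have s01 := hs 0 1 (by simp)
  have s02 := hs 0 2 (by simp)
  have s03 := hs 0 3 (by simp)
  have s04 := hs 0 4 (by simp)
  have s12 := hs 1 2 (by simp)
  have s13 := hs 1 3 (by simp)
  have s14 := hs 1 4 (by simp)
  have s23 := hs 2 3 (by simp)
  have s24 := hs 2 4 (by simp)
  have s34 := hs 3 4 (by simp)
  simp only [chordCrossing] at *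
  grind

lemma not_isCrossingCoboundary_completeBipartiteGraph
    {s : Fin 3 ⊕ Fin 3 → Fin 3 ⊕ Fin 3 → ZMod 2}
    {w : Fin 3 ⊕ Fin 3 → Fin 3 ⊕ Fin 3 → Fin 3 ⊕ Fin 3 → ZMod 2}
    (hs : ∀ x y, x ≠ y → s x y + s y x = 1) :
    ¬ IsCrossingCoboundary (completeBipartiteGraph (Fin 3) (Fin 3)) s w := by
  intro hw
  have h0 := hw (.inl 0) (.inr 0) (.inl 1) (.inr 1) (by simp) (by simp) (by simp) (by simp)
    (by simp) (by simp)
  have h1 := hw (.inl 0) (.inr 0) (.inl 1) (.inr 2) (by simp) (by simp) (by simp) (by simp)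
    (by simp) (by simp)
  have h2 := hw (.inl 0) (.inr 0) (.inl 2) (.inr 1) (by simp) (by simp) (by simp) (by simp)
    (by simp) (by simp)
  have h3 := hw (.inl 0) (.inr 0) (.inl 2) (.inr 2) (by simp) (by simp) (by simp) (by simp)
    (by simp) (by simp)
  have h4 := hw (.inl 0) (.inr 1) (.inl 1) (.inr 0) (by simp) (by simp) (by simp) (by simp)
    (by simp) (by simp)
  have h5 := hw (.inl 0) (.inr 1) (.inl 1) (.inr 2) (by simp) (by simp) (by simp) (by simp)
    (by simp) (by simp)
  have h6 := hw (.inl 0) (.inr 1) (.inl 2) (.inr 0) (by simp) (by simp) (by simp) (by simp)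
    (by simp) (by simp)
  have h7 := hw (.inl 0) (.inr 1) (.inl 2) (.inr 2) (by simp) (by simp) (by simp) (by simp)
    (by simp) (by simp)
  have h8 := hw (.inl 0) (.inr 2) (.inl 1) (.inr 0) (by simp) (by simp) (by simp) (by simp)
    (by simp) (by simp)
  have h9 := hw (.inl 0) (.inr 2) (.inl 1) (.inr 1) (by simp) (by simp) (by simp) (by simp)
    (by simp) (by simp)
  have h10 := hw (.inl 0) (.inr 2) (.inl 2) (.inr 0) (by simp) (by simp) (by simp) (by simp)
    (by simp) (by simp)
  have h11 := hw (.inl 0) (.inr 2) (.inl 2) (.inr 1) (by simp) (by simp) (by simp) (by simp)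
    (by simp) (by simp)
  have h12 := hw (.inl 1) (.inr 0) (.inl 2) (.inr 1) (by simp) (by simp) (by simp) (by simp)
    (by simp) (by simp)
  have h13 := hw (.inl 1) (.inr 0) (.inl 2) (.inr 2) (by simp) (by simp) (by simp) (by simp)
    (by simp) (by simp)
  have h14 := hw (.inl 1) (.inr 1) (.inl 2) (.inr 0) (by simp) (by simp) (by simp) (by simp)
    (by simp) (by simp)
  have h15 := hw (.inl 1) (.inr 1) (.inl 2) (.inr 2) (by simp) (by simp) (by simp) (by simp)
    (by simp) (by simp)
  have h16 := hw (.inl 1) (.inr 2) (.inl 2) (.inr 0) (by simp) (by simp) (by simp) (by simp)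
    (by simp) (by simp)
  have h17 := hw (.inl 1) (.inr 2) (.inl 2) (.inr 1) (by simp) (by simp) (by simp) (by simp)
    (by simp) (by simp)
  have s01 := hs (.inl 0) (.inl 1) (by simp)
  have s02 := hs (.inl 0) (.inl 2) (by simp)
  have s03 := hs (.inl 0) (.inr 0) (by simp)
  have s04 := hs (.inl 0) (.inr 1) (by simp)
  have s05 := hs (.inl 0) (.inr 2) (by simp)
  have s12 := hs (.inl 1) (.inl 2) (by simp)
  have s13 := hs (.inl 1) (.inr 0) (by simp)
  have s14 := hs (.inl 1) (.inr 1) (by simp)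
  have s15 := hs (.inl 1) (.inr 2) (by simp)
  have s23 := hs (.inl 2) (.inr 0) (by simp)
  have s24 := hs (.inl 2) (.inr 1) (by simp)
  have s25 := hs (.inl 2) (.inr 2) (by simp)
  have s34 := hs (.inr 0) (.inr 1) (by simp)
  have s35 := hs (.inr 0) (.inr 2) (by simp)
  have s45 := hs (.inr 1) (.inr 2) (by simp)
  simp only [chordCrossing] at *
  grind

theorem IsCrossingCoboundary.isPlanar {V : Type*} {G : SimpleGraph V} {s : V → V → ZMod 2}
    {w : V → V → V → ZMod 2} (hw : IsCrossingCoboundary G s w)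
    (hs : ∀ x y, x ≠ y → s x y + s y x = 1) : IsPlanar G := by
  constructor
  · intro h
    obtain ⟨s', w', hs', hw'⟩ := hw.of_containsSubdivision hs h
    exact not_isCrossingCoboundary_completeGraph hs' hw'
  · intro h
    obtain ⟨s', w', hs', hw'⟩ := hw.of_containsSubdivision hs h
    exact not_isCrossingCoboundary_completeBipartiteGraph hs' hw'

/-- The order `u₁, …, u_m, v_n, …, v₁` on the vertices of a ladder, as a bit. -/
def ladderOrder (m n : ℕ) : Fin m ⊕ Fin n → Fin m ⊕ Fin n → ZMod 2
  | .inl i, .inl k => if i < k then 1 else 0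
  | .inr j, .inr l => if l < j then 1 else 0
  | .inl _, .inr _ => 1
  | .inr _, .inl _ => 0

/-- Bits attached to a cross edge `e`: the first two components serve the vertices of the left
path below and above `e`, the last two those of the right path. -/
def crossWeight {m n : ℕ} (B : Fin m × Fin n → ZMod 2 × ZMod 2 × ZMod 2 × ZMod 2)
    (e : Fin m × Fin n) : Fin m ⊕ Fin n → ZMod 2
  | .inl k => if k < e.1 then (B e).1 else (B e).2.1
  | .inr l => if l < e.2 then (B e).2.2.1 else (B e).2.2.2

/-- The edge weight which is `crossWeight` on cross edges and zero on path edges. -/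
def ladderWeight {m n : ℕ} (B : Fin m × Fin n → ZMod 2 × ZMod 2 × ZMod 2 × ZMod 2) :
    Fin m ⊕ Fin n → Fin m ⊕ Fin n → Fin m ⊕ Fin n → ZMod 2
  | .inl i, .inr j => crossWeight B (i, j)
  | .inr j, .inl i => crossWeight B (i, j)
  | .inl _, .inl _ => fun _ => 0
  | .inr _, .inr _ => fun _ => 0

lemma ladderWeight_comm {m n : ℕ} (B : Fin m × Fin n → ZMod 2 × ZMod 2 × ZMod 2 × ZMod 2)
    (a b : Fin m ⊕ Fin n) : ladderWeight B a b = ladderWeight B b a := by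
  rcases a with i | j <;> rcases b with k | l <;> rfl

/-- The compatibility of the bits of a cross edge `e` with the cross edges in its four
quadrants. -/
def IsQuadrantCompatible {m n : ℕ} (cross : Finset (Fin m × Fin n)) (e : Fin m × Fin n)
    (b : ZMod 2 × ZMod 2 × ZMod 2 × ZMod 2) : Prop :=
  ∀ f ∈ cross,
    (e.1 < f.1 → f.2 < e.2 → b.2.1 + b.2.2.1 = 0) ∧
    (e.1 < f.1 → e.2 < f.2 → b.2.1 + b.2.2.2 = 0) ∧
    (f.1 < e.1 → e.2 < f.2 → b.1 + b.2.2.2 = 1) ∧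
    (f.1 < e.1 → f.2 < e.2 → b.1 + b.2.2.1 = 0)

lemma exists_isQuadrantCompatible {m n : ℕ} {cross : Finset (Fin m × Fin n)}
    {e : Fin m × Fin n}
    (h : Lup cross e ∩ Rdown cross e = ∅ ∨ Lup cross e ∩ Rup cross e = ∅ ∨
      Ldown cross e ∩ Rup cross e = ∅ ∨ Ldown cross e ∩ Rdown cross e = ∅) :
    ∃ b, IsQuadrantCompatible cross e b := by
  simp only [Lup, Ldown, Rup, Rdown, Finset.eq_empty_iff_forall_notMem, Finset.mem_inter,
    Finset.mem_filter, not_and] at h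
  rcases h with h | h | h | h
  · exact ⟨(0, 1, 0, 1), fun f hf => by
      have := h f; grind⟩
  · exact ⟨(0, 0, 0, 1), fun f hf => by
      have := h f; grind⟩
  · exact ⟨(0, 0, 0, 0), fun f hf => by
      have := h f; grind⟩
  · exact ⟨(1, 0, 0, 0), fun f hf => by
      have := h f; grind⟩

lemma chordCrossing_ladderOrder {m n : ℕ} {cross : Finset (Fin m × Fin n)}
    {B : Fin m × Fin n → ZMod 2 × ZMod 2 × ZMod 2 × ZMod 2}
    (hB : ∀ e ∈ cross, IsQuadrantCompatible cross e (B e)) {a b c d : Fin m ⊕ Fin n}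
    (hab : ladderRel m n cross a b) (hcd : ladderRel m n cross c d)
    (hac : a ≠ c) (had : a ≠ d) (hbc : b ≠ c) (hbd : b ≠ d) :
    chordCrossing (ladderOrder m n) a b c d =
      ladderWeight B a b c + ladderWeight B a b d +
        ladderWeight B c d a + ladderWeight B c d b := by
  rcases a with a | a <;> rcases b with b | b <;> rcases c with c | c <;> rcases d with d | d <;>
    simp only [ladderRel, ne_eq, Sum.inl.injEq, Sum.inr.injEq, reduceCtorEq,
      not_false_eq_true] at hab hcd hac had hbc hbd <;>
    simp only [chordCrossing, ladderOrder, ladderWeight, crossWeight]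
  case inl.inr.inl.inr =>
    have h₁ := hB _ hab _ hcd
    have h₂ := hB _ hcd _ hab
    grind
  all_goals grind

lemma isCrossingCoboundary_ladderGraph {m n : ℕ} {cross : Finset (Fin m × Fin n)}
    {B : Fin m × Fin n → ZMod 2 × ZMod 2 × ZMod 2 × ZMod 2}
    (hB : ∀ e ∈ cross, IsQuadrantCompatible cross e (B e)) :
    IsCrossingCoboundary (ladderGraph m n cross) (ladderOrder m n) (ladderWeight B) := by
  intro a b c d hab hcd hac had hbc hbd
  rcases hab.2 with hab | hab <;> rcases hcd.2 with hcd | hcd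
  · exact chordCrossing_ladderOrder hB hab hcd hac had hbc hbd
  · have := chordCrossing_ladderOrder hB hab hcd had hac hbd hbc
    rw [ladderWeight_comm B d c] at this
    simp only [chordCrossing] at *
    linear_combination this
  · have := chordCrossing_ladderOrder hB hab hcd hbc hbd hac had
    rw [ladderWeight_comm B b a] at this
    simp only [chordCrossing] at *
    linear_combination this
  · have := chordCrossing_ladderOrder hB hab hcd hbd hbc had hac
    rw [ladderWeight_comm B b a, ladderWeight_comm B d c] at this
    simp only [chordCrossing] at *
    linear_combination this

/-- If for each cross edge `e` at least one of the four sets `L↑(e) ∩ R↓(e)`,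
`L↑(e) ∩ R↑(e)`, `L↓(e) ∩ R↑(e)`, `L↓(e) ∩ R↓(e)` is empty, then the generalized ladder
graph is planar. -/
theorem ladder_planar_of_forall (m n : ℕ) (hm : 0 < m) (hn : 0 < n)
    (cross : Finset (Fin m × Fin n))
    (h : ∀ e ∈ cross,
        Lup cross e ∩ Rdown cross e = ∅ ∨
        Lup cross e ∩ Rup cross e = ∅ ∨
        Ldown cross e ∩ Rup cross e = ∅ ∨
        Ldown cross e ∩ Rdown cross e = ∅) :
    IsPlanar (ladderGraph m n cross) := by
  classical
  choose! B hB using fun e he => exists_isQuadrantCompatible (h e he)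
  refine (isCrossingCoboundary_ladderGraph hB).isPlanar (s := ladderOrder m n) ?_
  rintro (i | j) (k | l) hne <;> simp only [ladderOrder]
  all_goals grind
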